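/- arXiv:2311.14257 — 2 statements merged into one kernel-verified Lean document; each statement's English description precedes it below -/
import Mathlib

section
/- Let H be a nontrivial complex Hilbert space and let M be an atomless, σ-finite von Neumann algebra on H (σ-finiteness replaces the paper's hypothesis that M carries a faithful normal state, to which it is equivalent). Then for every sequence (y_n)_{n∈ℕ} in M and every ε > 0 there exists g ∈ M such that ‖g − y_n‖ > ‖y_n‖ + 1 − ε for all n ∈ ℕ. -/
noncomputable section

variable {H : Type*} [NormedAddCommGroup H] [InnerProductSpace ℂ H] [CompleteSpace H]

/-- `p` is a projection of the von Neumann algebra `M` : `p ∈ M`, `p = p*`, `p ∘ p = p`. -/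
def IsProjectionIn (M : VonNeumannAlgebra H) (p : H →L[ℂ] H) : Prop :=
  p ∈ M ∧ star p = p ∧ p * p = p

/-- `p` is a minimal projection of `M`. -/
def IsMinimalProjectionIn (M : VonNeumannAlgebra H) (p : H →L[ℂ] H) : Prop :=
  IsProjectionIn M p ∧ p ≠ 0 ∧
    ∀ q, IsProjectionIn M q → p * q = q → q = 0 ∨ q = p

/-- `M` is atomless if it has no minimal projections. -/
def VonNeumannAlgebra.Atomless (M : VonNeumannAlgebra H) : Prop :=
  ∀ p : H →L[ℂ] H, ¬ IsMinimalProjectionIn M p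

/-- `M` is σ-finite if every set of pairwise orthogonal nonzero projections of `M` is
countable. -/
def VonNeumannAlgebra.SigmaFinite (M : VonNeumannAlgebra H) : Prop :=
  ∀ S : Set (H →L[ℂ] H), (∀ p ∈ S, IsProjectionIn M p ∧ p ≠ 0) →
    (S.Pairwise fun p q => p * q = 0) → S.Countable

theorem IsProjectionIn.inner_eq {M : VonNeumannAlgebra H} {p : H →L[ℂ] H}
    (hp : IsProjectionIn M p) (x z : H) : inner ℂ (p x) z = inner ℂ x (p z) := by
  conv_lhs => rw [← hp.2.1, ContinuousLinearMap.star_eq_adjoint]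
  exact ContinuousLinearMap.adjoint_inner_left p z x

theorem IsProjectionIn.idem {M : VonNeumannAlgebra H} {p : H →L[ℂ] H}
    (hp : IsProjectionIn M p) (x : H) : p (p x) = p x := by
  have := congrArg (fun T : H →L[ℂ] H => T x) hp.2.2
  simpa using this

/-- Pythagoras for two orthogonal vectors. -/
theorem norm_sq_add_of_inner_eq_zero (x z : H) (h : inner ℂ x z = 0) :
    ‖x + z‖ ^ 2 = ‖x‖ ^ 2 + ‖z‖ ^ 2 := by
  have := norm_add_sq_eq_norm_sq_add_norm_sq_of_inner_eq_zero x z h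
  nlinarith

theorem IsProjectionIn.pyth {M : VonNeumannAlgebra H} {p : H →L[ℂ] H}
    (hp : IsProjectionIn M p) (x : H) : ‖p x‖ ^ 2 + ‖x - p x‖ ^ 2 = ‖x‖ ^ 2 := by
  rw [← norm_sq_add_of_inner_eq_zero]
  · congr 2; abel
  · rw [hp.inner_eq, map_sub, hp.idem]; simp

theorem IsProjectionIn.norm_le {M : VonNeumannAlgebra H} {p : H →L[ℂ] H}
    (hp : IsProjectionIn M p) (x : H) : ‖p x‖ ≤ ‖x‖ := by
  have := hp.pyth x
  exact abs_le_of_sq_le_sq' (by nlinarith [sq_nonneg ‖x - p x‖]) (norm_nonneg _) |>.2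

theorem IsProjectionIn.norm_sub_le {M : VonNeumannAlgebra H} {p : H →L[ℂ] H}
    (hp : IsProjectionIn M p) (x : H) : ‖x - p x‖ ≤ ‖x‖ := by
  have := hp.pyth x
  exact abs_le_of_sq_le_sq' (by nlinarith [sq_nonneg ‖p x‖]) (norm_nonneg _) |>.2

/-- The projection onto a closed subspace invariant under the commutant lies in `M`. -/
theorem isProjectionIn_starProjection (M : VonNeumannAlgebra H) (K : Submodule ℂ H)
    [K.HasOrthogonalProjection] (hK : ∀ c ∈ M.commutant, ∀ x ∈ K, c x ∈ K) :
    IsProjectionIn M K.starProjection := by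
  have h : IsStarProjection K.starProjection := isStarProjection_starProjection
  refine ⟨?_, h.isSelfAdjoint.star_eq, h.isIdempotentElem⟩
  rw [VonNeumannAlgebra.IsStarProjection.mem_iff h]
  intro c hc
  rw [Submodule.range_starProjection]
  exact fun x hx => hK c hc x hx

theorem comm_apply {M : VonNeumannAlgebra H} {a c : H →L[ℂ] H} (ha : a ∈ M)
    (hc : c ∈ M.commutant) (x : H) : a (c x) = c (a x) := by
  have := congrArg (fun T : H →L[ℂ] H => T x)
    (VonNeumannAlgebra.mem_commutant_iff.1 hc a ha)
  simpa using this

theorem smul_mem_vN {M : VonNeumannAlgebra H} {a : H →L[ℂ] H} (r : ℂ) (ha : a ∈ M) :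
    r • a ∈ M := M.toStarSubalgebra.smul_mem ha r

/-- A spectral projection on which `u` almost attains its norm. -/
theorem exists_spectral (M : VonNeumannAlgebra H) (u : H →L[ℂ] H) (hu : u ∈ M)
    (c : ℝ) (hc0 : 0 < c) (hc : c < ‖u‖ ^ 2) :
    ∃ e, IsProjectionIn M e ∧ e ≠ 0 ∧ ∀ x, e x = x → c * ‖x‖ ^ 2 ≤ ‖u x‖ ^ 2 := by
  set a : H →L[ℂ] H := star u * u - (c : ℂ) • 1 with ha
  have hsa : IsSelfAdjoint a := by
    refine (IsSelfAdjoint.star_mul_self u).sub ?_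
    rw [isSelfAdjoint_iff]; simp
  have haM : a ∈ M := sub_mem (mul_mem (star_mem hu) hu) (smul_mem_vN _ (one_mem M))
  have hinner : ∀ x, (inner ℂ (a x) x).re = ‖u x‖ ^ 2 - c * ‖x‖ ^ 2 := by
    intro x
    have h1 : inner ℂ ((star u * u) x) x = inner ℂ (u x) (u x) := by
      rw [ContinuousLinearMap.star_eq_adjoint]
      exact ContinuousLinearMap.adjoint_inner_left u x (u x)
    rw [ha, sub_apply, inner_sub_left, h1, inner_self_eq_norm_sq_to_K]
    simp only [smul_apply, one_apply, inner_smul_left, inner_self_eq_norm_sq_to_K]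
    simp [← Complex.ofReal_pow]
  have hnegc : ∀ z ∈ M.commutant, ∀ x, a⁻ (z x) = z (a⁻ x) := by
    intro z hz x
    have h1 : Commute a z := VonNeumannAlgebra.mem_commutant_iff.1 hz a haM
    have h2 : Commute a⁻ z := by
      rw [CFC.negPart_def]; exact h1.cfcₙ_real _
    have := congrArg (fun T : H →L[ℂ] H => T x) h2.eq
    simpa using this
  have hdec : ∀ x, a x = a⁺ x - a⁻ x := by
    intro x
    conv_lhs => rw [← CFC.posPart_sub_negPart a hsa]
    rfl
  have hpos : ∀ x, 0 ≤ (inner ℂ (a⁺ x) x).re := fun x =>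
    ((ContinuousLinearMap.nonneg_iff_isPositive _).1 (CFC.posPart_nonneg a)).re_inner_nonneg_left x
  have hneg : ∀ x, 0 ≤ (inner ℂ (a⁻ x) x).re := fun x =>
    ((ContinuousLinearMap.nonneg_iff_isPositive _).1 (CFC.negPart_nonneg a)).re_inner_nonneg_left x
  let K : Submodule ℂ H := LinearMap.ker (a⁻ : H →L[ℂ] H).toLinearMap
  have hKmem : ∀ x, x ∈ K ↔ a⁻ x = 0 := fun x => Iff.rfl
  have hKc : IsClosed (K : Set H) := (a⁻).isClosed_ker
  have : CompleteSpace K := hKc.completeSpace_coe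
  refine ⟨K.starProjection, isProjectionIn_starProjection M K ?_, ?_, ?_⟩
  · intro z hz x hx
    rw [hKmem] at hx ⊢
    rw [hnegc z hz, hx, map_zero]
  · intro h0
    have hap : ∀ x, a⁺ x = 0 := by
      intro x
      have hx : a⁺ x ∈ K := by
        rw [hKmem]
        have := congrArg (fun T : H →L[ℂ] H => T x) (CFC.negPart_mul_posPart a)
        exact this
      rw [← Submodule.starProjection_eq_self_iff.2 hx, h0]; rfl
    have hle : ‖u‖ ≤ √c := by
      refine ContinuousLinearMap.opNorm_le_bound _ (Real.sqrt_nonneg _) fun x => ?_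
      have h1 := hinner x
      rw [hdec, hap, zero_sub, inner_neg_left, Complex.neg_re] at h1
      have h2 := hneg x
      refine (abs_le_of_sq_le_sq' ?_ (by positivity)).2
      rw [mul_pow, Real.sq_sqrt hc0.le]; linarith
    have : ‖u‖ ^ 2 ≤ √c ^ 2 := pow_le_pow_left₀ (norm_nonneg _) hle 2
    rw [Real.sq_sqrt hc0.le] at this
    linarith
  · intro x hx
    have hxK : a⁻ x = 0 := (hKmem x).1 (Submodule.starProjection_eq_self_iff.1 hx)
    have h1 := hinner x
    rw [hdec, hxK, sub_zero] at h1
    linarith [hpos x]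

/-- Small subprojections in an atomless algebra. -/
theorem exists_small (M : VonNeumannAlgebra H) (hM : M.Atomless) (e : H →L[ℂ] H)
    (he : IsProjectionIn M e) (he0 : e ≠ 0) (F : Finset H) (k : ℕ) :
    ∃ p, IsProjectionIn M p ∧ p ≠ 0 ∧ e * p = p ∧
      ∑ v ∈ F, ‖p v‖ ^ 2 ≤ (∑ v ∈ F, ‖e v‖ ^ 2) / 2 ^ k := by
  induction k with
  | zero => exact ⟨e, he, he0, he.2.2, by simp⟩
  | succ k ih =>
    obtain ⟨p, hp, hp0, hep, hs⟩ := ih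
    have hnm := hM p
    unfold IsMinimalProjectionIn at hnm
    push Not at hnm
    obtain ⟨q, hq, hpq, hq0, hqp⟩ := hnm hp hp0
    have hqp' : q * p = q := by
      have := congrArg star hpq
      rwa [star_mul, hq.2.1, hp.2.1] at this
    have hr : IsProjectionIn M (p - q) := by
      refine ⟨sub_mem hp.1 hq.1, by rw [star_sub, hp.2.1, hq.2.1], ?_⟩
      rw [sub_mul, mul_sub, mul_sub, hp.2.2, hpq, hqp', hq.2.2]; abel
    have hsum : ∑ v ∈ F, ‖q v‖ ^ 2 + ∑ v ∈ F, ‖(p - q) v‖ ^ 2 = ∑ v ∈ F, ‖p v‖ ^ 2 := by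
      rw [← Finset.sum_add_distrib]
      refine Finset.sum_congr rfl fun v _ => ?_
      have h1 : q (p v) = q v := congrArg (fun T : H →L[ℂ] H => T v) hqp'
      have := hq.pyth (p v)
      rwa [h1] at this
    have hk : (∑ v ∈ F, ‖e v‖ ^ 2) / 2 ^ (k + 1) = ((∑ v ∈ F, ‖e v‖ ^ 2) / 2 ^ k) / 2 := by
      rw [pow_succ, div_div]
    rw [hk]
    by_cases h : ∑ v ∈ F, ‖q v‖ ^ 2 ≤ ((∑ v ∈ F, ‖e v‖ ^ 2) / 2 ^ k) / 2
    · refine ⟨q, hq, hq0, ?_, h⟩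
      rw [← hpq, ← mul_assoc, hep]
    · refine ⟨p - q, hr, sub_ne_zero.2 (Ne.symm hqp), ?_, by linarith⟩
      rw [mul_sub, hep]
      conv_lhs => rw [← hpq, ← mul_assoc, hep, hpq]

theorem exists_small' (M : VonNeumannAlgebra H) (hM : M.Atomless) (e : H →L[ℂ] H)
    (he : IsProjectionIn M e) (he0 : e ≠ 0) (F : Finset H) (κ : ℝ) (hκ : 0 < κ) :
    ∃ p, IsProjectionIn M p ∧ p ≠ 0 ∧ e * p = p ∧ ∀ v ∈ F, ‖p v‖ ≤ κ := by
  obtain ⟨k, hk⟩ := pow_unbounded_of_one_lt ((∑ v ∈ F, ‖e v‖ ^ 2) / κ ^ 2)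
    (one_lt_two : (1 : ℝ) < 2)
  obtain ⟨p, hp, hp0, hep, hs⟩ := exists_small M hM e he he0 F k
  refine ⟨p, hp, hp0, hep, fun v hv => ?_⟩
  have h1 : ‖p v‖ ^ 2 ≤ ∑ v ∈ F, ‖p v‖ ^ 2 :=
    Finset.single_le_sum (f := fun v => ‖p v‖ ^ 2) (fun _ _ => sq_nonneg _) hv
  have h2 : (∑ v ∈ F, ‖e v‖ ^ 2) / 2 ^ k ≤ κ ^ 2 := by
    rw [div_le_iff₀ (by positivity)]
    rw [div_lt_iff₀ (by positivity)] at hk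
    linarith
  exact (abs_le_of_sq_le_sq' (by linarith) hκ.le).2

/-- The inductive step. -/
theorem step (M : VonNeumannAlgebra H) (hM : M.Atomless) (u : H →L[ℂ] H) (hu : u ∈ M)
    (hu1 : ‖u‖ = 1) (δ : ℝ) (hδ : 0 < δ) (g : H →L[ℂ] H) (hg : g ∈ M) (hg1 : ‖g‖ ≤ 1)
    (F : Finset (H × H × ℝ)) (hF : ∀ t ∈ F, (inner ℂ (g t.1) t.2.1).re < t.2.2) :
    ∃ g' ∈ M, ‖g'‖ ≤ 1 ∧ (∀ t ∈ F, (inner ℂ (g' t.1) t.2.1).re < t.2.2) ∧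
      ∃ x : H, ‖x‖ = 1 ∧ 1 - δ < ‖u x‖ ^ 2 ∧ (inner ℂ (g' x) (u x)).re < - 1 + δ := by
  classical
  -- tolerance
  obtain ⟨κ, hκ, hκF⟩ : ∃ κ : ℝ, 0 < κ ∧ ∀ t ∈ F,
      (inner ℂ (g t.1) t.2.1).re + 2 * κ * (‖t.1‖ + ‖t.2.1‖) < t.2.2 := by
    have h : ∀ᶠ κ : ℝ in nhdsWithin 0 (Set.Ioi 0), ∀ t ∈ F,
        (inner ℂ (g t.1) t.2.1).re + 2 * κ * (‖t.1‖ + ‖t.2.1‖) < t.2.2 := by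
      rw [Filter.eventually_all_finset]
      intro t ht
      have hc : Continuous fun κ : ℝ =>
        (inner ℂ (g t.1) t.2.1).re + 2 * κ * (‖t.1‖ + ‖t.2.1‖) := by fun_prop
      refine Filter.Eventually.filter_mono nhdsWithin_le_nhds ?_
      exact hc.continuousAt.eventually_lt continuousAt_const (by simpa using hF t ht)
    obtain ⟨κ, h1, h2⟩ := (h.and self_mem_nhdsWithin).exists
    exact ⟨κ, h2, h1⟩
  obtain ⟨c, hc1, hc2, hcδ⟩ : ∃ c : ℝ, 1 / 4 ≤ c ∧ c < 1 ∧ 1 - δ < c := by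
    refine ⟨max (1 / 4) (1 - δ / 2), le_max_left _ _, max_lt (by norm_num) (by linarith), ?_⟩
    exact lt_of_lt_of_le (by linarith) (le_max_right _ _)
  obtain ⟨e, he, he0, hce⟩ := exists_spectral M u hu c (by linarith) (by rw [hu1]; linarith)
  obtain ⟨p, hp, hp0, hep, hsmall⟩ := exists_small' M hM e he he0
    (F.image (fun t => t.1) ∪ F.image (fun t => star u t.2.1)) κ hκ
  have hcp : ∀ x, c * ‖p x‖ ^ 2 ≤ ‖u (p x)‖ ^ 2 := fun x =>
    hce _ (congrArg (fun T : H →L[ℂ] H => T x) hep)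
  have hun : ∀ x, ‖u x‖ ≤ ‖x‖ := fun x => by simpa [hu1] using u.le_opNorm x
  have hgn : ∀ x, ‖g x‖ ≤ ‖x‖ := fun x =>
    (g.le_opNorm x).trans (mul_le_of_le_one_left (norm_nonneg _) hg1)
  -- the range projection
  let K : Submodule ℂ H := (LinearMap.range (u * p).toLinearMap).topologicalClosure
  have hKc : IsClosed (K : Set H) := Submodule.isClosed_topologicalClosure _
  have : CompleteSpace K := hKc.completeSpace_coe
  have hKr : ∀ x, u (p x) ∈ K := fun x =>
    Submodule.le_topologicalClosure _ ⟨x, rfl⟩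
  have hKind : ∀ C : Set H, IsClosed C → (∀ x, u (p x) ∈ C) → ∀ z ∈ K, z ∈ C := by
    intro C hC h z hz
    have : z ∈ closure ((LinearMap.range (u * p).toLinearMap : Submodule ℂ H) : Set H) := hz
    refine closure_minimal ?_ hC this
    rintro _ ⟨x, rfl⟩
    exact h x
  obtain ⟨f, hfdef⟩ : ∃ f, f = K.starProjection := ⟨_, rfl⟩
  have hf : IsProjectionIn M f := by
    rw [hfdef]
    refine isProjectionIn_starProjection M K fun z hz x hx => ?_
    refine hKind (z ⁻¹' (K : Set H)) (hKc.preimage z.continuous) (fun x => ?_) x hx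
    show z (u (p x)) ∈ K
    rw [← comm_apply hu hz, ← comm_apply hp.1 hz]
    exact hKr _
  have hfu : ∀ x, f (u (p x)) = u (p x) := fun x => by
    rw [hfdef]; exact Submodule.starProjection_eq_self_iff.2 (hKr x)
  have hfw : ∀ w, ‖f w‖ ≤ 2 * ‖p (star u w)‖ := by
    intro w
    have hKw : ∀ z ∈ K, ‖(inner ℂ w z : ℂ)‖ ≤ 2 * ‖p (star u w)‖ * ‖z‖ := by
      refine hKind {z | ‖(inner ℂ w z : ℂ)‖ ≤ 2 * ‖p (star u w)‖ * ‖z‖}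
        (isClosed_le (by fun_prop) (by fun_prop)) fun x => ?_
      show ‖(inner ℂ w (u (p x)) : ℂ)‖ ≤ 2 * ‖p (star u w)‖ * ‖u (p x)‖
      have h1 : inner ℂ w (u (p x)) = inner ℂ (p (star u w)) (p x) := by
        rw [hp.inner_eq, hp.idem, ContinuousLinearMap.star_eq_adjoint]
        exact (ContinuousLinearMap.adjoint_inner_left u (p x) w).symm
      have h2 : ‖p x‖ ≤ 2 * ‖u (p x)‖ := by
        refine (abs_le_of_sq_le_sq' ?_ (by positivity)).2
        nlinarith [hcp x, sq_nonneg ‖p x‖]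
      rw [h1]
      calc _ ≤ ‖p (star u w)‖ * ‖p x‖ := norm_inner_le_norm _ _
        _ ≤ ‖p (star u w)‖ * (2 * ‖u (p x)‖) := by gcongr
        _ = _ := by ring
    have h3 := hKw (f w) (by rw [hfdef]; exact Submodule.starProjection_apply_mem K w)
    have h4 : inner ℂ w (f w) = inner ℂ (f w) (f w) := by rw [hf.inner_eq, hf.idem]
    rw [h4, inner_self_eq_norm_sq_to_K, norm_pow, RCLike.norm_ofReal, abs_norm] at h3
    by_cases h0 : ‖f w‖ = 0
    · rw [h0]; positivity
    · have : 0 < ‖f w‖ := lt_of_le_of_ne (norm_nonneg _) (Ne.symm h0)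
      exact le_of_mul_le_mul_right (by nlinarith) this
  let g' : H →L[ℂ] H := (1 - f) * g * (1 - p) - u * p
  have hg'a : ∀ x, g' x = (g (x - p x) - f (g (x - p x))) - u (p x) := fun x => rfl
  refine ⟨g', ?_, ?_, ?_, ?_⟩
  · exact sub_mem (mul_mem (mul_mem (sub_mem (one_mem M) hf.1) hg) (sub_mem (one_mem M) hp.1))
      (mul_mem hu hp.1)
  · refine ContinuousLinearMap.opNorm_le_bound _ zero_le_one fun x => ?_
    rw [one_mul, hg'a]
    refine (abs_le_of_sq_le_sq' ?_ (norm_nonneg _)).2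
    rw [sub_eq_add_neg _ (u (p x)), norm_sq_add_of_inner_eq_zero, norm_neg, ← hp.pyth x]
    · have h1 := (hf.norm_sub_le (g (x - p x))).trans (hgn _)
      have h2 := hun (p x)
      have h3 := pow_le_pow_left₀ (norm_nonneg _) h1 2
      have h4 := pow_le_pow_left₀ (norm_nonneg _) h2 2
      linarith
    · rw [inner_neg_right, ← hfu x, ← hf.inner_eq, map_sub, hf.idem]; simp
  · intro t ht
    have hv : ‖p t.1‖ ≤ κ := hsmall _ (Finset.mem_union_left _ (Finset.mem_image_of_mem _ ht))
    have hw : ‖p (star u t.2.1)‖ ≤ κ := hsmall _ (Finset.mem_union_right _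
      (Finset.mem_image_of_mem (fun t : H × H × ℝ => star u t.2.1) ht))
    refine lt_of_le_of_lt ?_ (hκF t ht)
    have hexp : inner ℂ (g' t.1) t.2.1 = inner ℂ (g t.1) t.2.1 - inner ℂ (g (p t.1)) t.2.1
        - inner ℂ (g (t.1 - p t.1)) (f t.2.1) - inner ℂ (u (p t.1)) t.2.1 := by
      rw [hg'a, inner_sub_left, inner_sub_left, hf.inner_eq, map_sub, inner_sub_left]
    have b1 : ‖(inner ℂ (g (p t.1)) t.2.1 : ℂ)‖ ≤ κ * ‖t.2.1‖ :=
      (norm_inner_le_norm _ _).trans (by gcongr; exact (hgn _).trans hv)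
    have b2 : ‖(inner ℂ (u (p t.1)) t.2.1 : ℂ)‖ ≤ κ * ‖t.2.1‖ :=
      (norm_inner_le_norm _ _).trans (by gcongr; exact (hun _).trans hv)
    have b3 : ‖(inner ℂ (g (t.1 - p t.1)) (f t.2.1) : ℂ)‖ ≤ ‖t.1‖ * (2 * κ) :=
      (norm_inner_le_norm _ _).trans (by
        gcongr
        · exact (hgn _).trans (hp.norm_sub_le _)
        · exact (hfw _).trans (by gcongr))
    have c1 := (abs_le.1 ((Complex.abs_re_le_norm _).trans b1)).1
    have c2 := (abs_le.1 ((Complex.abs_re_le_norm _).trans b2)).1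
    have c3 := (abs_le.1 ((Complex.abs_re_le_norm _).trans b3)).1
    rw [hexp, Complex.sub_re, Complex.sub_re, Complex.sub_re]
    nlinarith
  · obtain ⟨z, hz⟩ : ∃ z, p z ≠ 0 := by
      by_contra h
      push Not at h
      exact hp0 (ContinuousLinearMap.ext h)
    have hpos : 0 < ‖p z‖ := norm_pos_iff.2 hz
    set x : H := ((‖p z‖⁻¹ : ℝ) : ℂ) • p z with hx
    have hpx : p x = x := by rw [hx, map_smul, hp.idem]
    have hx1 : ‖x‖ = 1 := by
      rw [hx, norm_smul, Complex.norm_real, norm_inv, norm_norm, inv_mul_cancel₀ hpos.ne']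
    have hux : c ≤ ‖u x‖ ^ 2 := by
      have := hcp x
      rwa [hpx, hx1, one_pow, mul_one] at this
    refine ⟨x, hx1, by linarith, ?_⟩
    have : g' x = - u x := by rw [hg'a, hpx]; simp
    rw [this, inner_neg_left, inner_self_eq_norm_sq_to_K]
    simp only [Complex.neg_re]
    simp [← Complex.ofReal_pow]
    linarith

/-- Weak cluster points of bounded sequences in `M`. -/
theorem exists_weak_limit (M : VonNeumannAlgebra H) (g : ℕ → (H →L[ℂ] H))
    (hg : ∀ n, g n ∈ M) (hg1 : ∀ n, ‖g n‖ ≤ 1) :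
    ∃ G ∈ M, ∀ v w : H, Filter.Tendsto (fun n => inner ℂ (g n v) w)
      (Filter.hyperfilter ℕ : Filter ℕ) (nhds (inner ℂ (G v) w)) := by
  have hb : ∀ n v w, ‖(inner ℂ (g n v) w : ℂ)‖ ≤ ‖v‖ * ‖w‖ := fun n v w =>
    (norm_inner_le_norm _ _).trans (by
      gcongr
      exact ((g n).le_opNorm v).trans (mul_le_of_le_one_left (norm_nonneg _) (hg1 n)))
  have hex : ∀ v w : H, ∃ l : ℂ, ‖l‖ ≤ ‖v‖ * ‖w‖ ∧
      Filter.Tendsto (fun n => inner ℂ (g n v) w) (Filter.hyperfilter ℕ : Filter ℕ) (nhds l) := by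
    intro v w
    obtain ⟨l, hl, hlim⟩ := (isCompact_closedBall (0 : ℂ) (‖v‖ * ‖w‖)).ultrafilter_le_nhds
      ((Filter.hyperfilter ℕ).map (fun n => inner ℂ (g n v) w)) (by
        rw [Filter.le_principal_iff]
        show ∀ᶠ n in (Filter.hyperfilter ℕ : Filter ℕ), _ ∈ _
        refine Filter.Eventually.of_forall fun n => ?_
        simpa using hb n v w)
    exact ⟨l, by simpa using hl, hlim⟩
  choose L hLb hL using hex
  have huniq : ∀ {v w : H} {l : ℂ}, Filter.Tendsto (fun n => inner ℂ (g n v) w)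
      (Filter.hyperfilter ℕ : Filter ℕ) (nhds l) → L v w = l := fun h =>
    tendsto_nhds_unique (hL _ _) h
  let B0 : H →ₗ⋆[ℂ] H →ₗ[ℂ] ℂ := LinearMap.mk₂'ₛₗ (starRingEnd ℂ) (RingHom.id ℂ) L
    (fun v v' w => huniq (by simpa [inner_add_left] using (hL v w).add (hL v' w)))
    (fun r v w => huniq (by
      simpa only [map_smul, inner_smul_left, smul_eq_mul] using (hL v w).const_mul (starRingEnd ℂ r)))
    (fun v w w' => huniq (by simpa [inner_add_right] using (hL v w).add (hL v w')))
    (fun r v w => huniq (by simpa [inner_smul_right] using (hL v w).const_mul _))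
  let B : H →L⋆[ℂ] H →L[ℂ] ℂ := B0.mkContinuous₂ 1 (fun v w => by
    rw [one_mul]; exact hLb v w)
  let G := InnerProductSpace.continuousLinearMapOfBilin B
  have hG : ∀ v w, inner ℂ (G v) w = L v w := fun v w =>
    InnerProductSpace.continuousLinearMapOfBilin_apply B v w
  refine ⟨G, ?_, fun v w => by rw [hG]; exact hL v w⟩
  rw [← M.commutant_commutant, VonNeumannAlgebra.mem_commutant_iff]
  intro z hz
  ext v
  refine ext_inner_right ℂ fun w => ?_
  show inner ℂ (z (G v)) w = inner ℂ (G (z v)) w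
  rw [← ContinuousLinearMap.adjoint_inner_right, hG, hG]
  refine huniq ?_
  refine (hL (z v) w).congr fun n => ?_
  rw [comm_apply (hg n) hz, ContinuousLinearMap.adjoint_inner_right]

theorem exists_common (M : VonNeumannAlgebra H) (hM : M.Atomless) (u : ℕ → (H →L[ℂ] H))
    (hu : ∀ n, u n ∈ M) (hu1 : ∀ n, ‖u n‖ = 1) (δ : ℕ → ℝ) (hδ : ∀ n, 0 < δ n) :
    ∃ G ∈ M, ∀ n, ∃ x : H, ‖x‖ = 1 ∧ 1 - δ n < ‖u n x‖ ^ 2 ∧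
      (inner ℂ (G x) (u n x)).re ≤ - 1 + δ n := by
  classical
  let S := {s : (H →L[ℂ] H) × Finset (H × H × ℝ) // s.1 ∈ M ∧ ‖s.1‖ ≤ 1 ∧
    ∀ t ∈ s.2, (inner ℂ (s.1 t.1) t.2.1).re < t.2.2}
  have hstep : ∀ (n : ℕ) (s : S), ∃ s' : S, s.1.2 ⊆ s'.1.2 ∧ ∃ x : H, ‖x‖ = 1 ∧
      1 - δ n < ‖u n x‖ ^ 2 ∧ (x, u n x, -1 + δ n) ∈ s'.1.2 := by
    rintro n ⟨⟨g, F⟩, hg, hg1, hF⟩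
    obtain ⟨g', hg', hg1', hF', x, hx, hux, hgx⟩ :=
      step M hM (u n) (hu n) (hu1 n) (δ n) (hδ n) g hg hg1 F hF
    refine ⟨⟨⟨g', insert (x, u n x, -1 + δ n) F⟩, hg', hg1', ?_⟩,
      Finset.subset_insert _ _, x, hx, hux, Finset.mem_insert_self _ _⟩
    intro t ht
    rcases Finset.mem_insert.1 ht with rfl | ht
    · exact hgx
    · exact hF' t ht
  choose nxt hsub x hx hux hmem using hstep
  let s : ℕ → S := fun n => Nat.rec ⟨⟨0, ∅⟩, zero_mem M, by simp, by simp⟩ nxt n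
  have hs : ∀ n, s (n + 1) = nxt n (s n) := fun n => rfl
  have hmono : Monotone fun n => (s n).1.2 := monotone_nat_of_le_succ fun n => by
    simp only [hs]; exact hsub n (s n)
  obtain ⟨G, hG, hlim⟩ := exists_weak_limit M (fun n => (s n).1.1) (fun n => (s n).2.1)
    (fun n => (s n).2.2.1)
  refine ⟨G, hG, fun n => ⟨x n (s n), hx n (s n), hux n (s n), ?_⟩⟩
  refine le_of_tendsto ((Complex.continuous_re.tendsto _).comp
    (hlim (x n (s n)) (u n (x n (s n))))) ?_
  have hev : ∀ᶠ k in (Filter.hyperfilter ℕ : Filter ℕ), n + 1 ≤ k := by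
    refine Filter.Eventually.filter_mono Nat.hyperfilter_le_atTop (Filter.eventually_ge_atTop _)
  filter_upwards [hev] with k hk
  exact ((s k).2.2.2 _ (hmono hk (hmem n (s n)))).le

/-- **Proposition 3.4.** Let `M` be an atomless σ-finite von Neumann
algebra on a nontrivial Hilbert space `H`.  Then for every sequence `(y_n)` in `M`
and every `ε > 0` there exists `g ∈ M` with `‖g - y_n‖ > ‖y_n‖ + 1 - ε` for all `n`. -/
theorem exists_far_elt_of_atomless_sigmaFinite [Nontrivial H]
    (M : VonNeumannAlgebra H) (hM : M.Atomless) (hσ : M.SigmaFinite)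
    (y : ℕ → (H →L[ℂ] H)) (hy : ∀ n, y n ∈ M) (ε : ℝ) (hε : 0 < ε) :
    ∃ g ∈ M, ∀ n, ‖g - y n‖ > ‖y n‖ + 1 - ε := by
  classical
  have hdec : ∀ n, ∃ u ∈ M, ‖u‖ = 1 ∧ y n = (‖y n‖ : ℂ) • u := by
    intro n
    by_cases h : y n = 0
    · exact ⟨1, one_mem M, norm_one, by simp [h]⟩
    · have h0 : ‖y n‖ ≠ 0 := norm_ne_zero_iff.2 h
      refine ⟨((‖y n‖⁻¹ : ℝ) : ℂ) • y n, smul_mem_vN _ (hy n), ?_, ?_⟩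
      · rw [norm_smul, Complex.norm_real, norm_inv, norm_norm, inv_mul_cancel₀ h0]
      · rw [smul_smul, ← Complex.ofReal_mul, mul_inv_cancel₀ h0]; simp
  choose u hu hu1 hyu using hdec
  obtain ⟨G, hG, hx⟩ := exists_common M hM u hu hu1 (fun n => ε / (2 * (‖y n‖ + 1)))
    (fun n => by positivity)
  refine ⟨G, hG, fun n => ?_⟩
  obtain ⟨x, hx1, hux, hGx⟩ := hx n
  have hux1 : ‖u n x‖ ≤ 1 := by simpa [hu1, hx1] using (u n).le_opNorm x
  have h1 : ‖(inner ℂ ((G - y n) x) (u n x) : ℂ)‖ ≤ ‖G - y n‖ := by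
    refine (norm_inner_le_norm _ _).trans ?_
    have := (G - y n).le_opNorm x
    rw [hx1, mul_one] at this
    calc _ ≤ ‖G - y n‖ * 1 := by gcongr
      _ = _ := mul_one _
  have h2 : (inner ℂ ((G - y n) x) (u n x)).re =
      (inner ℂ (G x) (u n x)).re - ‖y n‖ * ‖u n x‖ ^ 2 := by
    have h3 : y n x = (‖y n‖ : ℂ) • u n x := congrArg (fun T : H →L[ℂ] H => T x) (hyu n)
    rw [ContinuousLinearMap.sub_apply, inner_sub_left, h3, inner_smul_left,
      inner_self_eq_norm_sq_to_K]
    simp [← Complex.ofReal_pow]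
  have h4 := (abs_le.1 ((Complex.abs_re_le_norm _).trans h1)).1
  rw [h2] at h4
  have hδ : ε / (2 * (‖y n‖ + 1)) * (‖y n‖ + 1) = ε / 2 := by field_simp
  have h5 : ‖y n‖ * (1 - ε / (2 * (‖y n‖ + 1))) ≤ ‖y n‖ * ‖u n x‖ ^ 2 := by gcongr
  show ‖y n‖ + 1 - ε < ‖G - y n‖
  nlinarith
end
end

section
/- Let H be a nontrivial complex Hilbert space and let M be an atomless, semifinite von Neumann algebra on H. Then for every sequence (y_n)_{n∈ℕ} in M and every ε > 0 there exists g in the compact ideal J(M) such that ‖g − y_n‖ > ‖y_n‖ + 1 − ε for all n ∈ ℕ. -/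
noncomputable section

variable {H : Type*} [NormedAddCommGroup H] [InnerProductSpace ℂ H] [CompleteSpace H]

/-- `p` is a finite projection of `M` in the Murray–von Neumann sense: every projection
`q ≤ p` of `M` that is Murray–von Neumann equivalent to `p` equals `p`. -/
def IsFiniteProjectionIn (M : VonNeumannAlgebra H) (p : H →L[ℂ] H) : Prop :=
  IsProjectionIn M p ∧
    ∀ q, IsProjectionIn M q → p * q = q →
      (∃ v ∈ M, star v * v = p ∧ v * star v = q) → q = p

/-- `M` is semifinite: every nonzero projection of `M` dominates a nonzero finite
projection of `M`. -/
def VonNeumannAlgebra.Semifinite (M : VonNeumannAlgebra H) : Prop :=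
  ∀ p, IsProjectionIn M p → p ≠ 0 →
    ∃ q, IsFiniteProjectionIn M q ∧ q ≠ 0 ∧ p * q = q

/-- The compact ideal `J(M)`: the operator-norm closure of the linear span of
`{a ∘ p ∘ b : a, b ∈ M, p a finite projection of M}`. -/
def compactIdeal (M : VonNeumannAlgebra H) : Set (H →L[ℂ] H) :=
  closure (Submodule.span ℂ
    {x : H →L[ℂ] H | ∃ a b p, a ∈ M ∧ b ∈ M ∧ IsFiniteProjectionIn M p ∧ x = a * p * b} :
    Set (H →L[ℂ] H))

lemma mem_vN_of_commute (M : VonNeumannAlgebra H) (b : H →L[ℂ] H)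
    (h : ∀ m ∈ M.commutant, m * b = b * m) : b ∈ M := by
  rw [← M.commutant_commutant, VonNeumannAlgebra.mem_commutant_iff]
  exact h

lemma proj_starProjection_mem (M : VonNeumannAlgebra H) (K : Submodule ℂ H)
    [K.HasOrthogonalProjection]
    (h : ∀ m ∈ M.commutant, ∀ x ∈ K, m x ∈ K) : IsProjectionIn M K.starProjection := by
  have hs : IsStarProjection K.starProjection := isStarProjection_starProjection
  refine ⟨?_, hs.isSelfAdjoint.star_eq, hs.isIdempotentElem⟩
  rw [VonNeumannAlgebra.IsStarProjection.mem_iff hs]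
  intro m hm
  rw [Module.End.mem_invtSubmodule]
  intro x hx
  have : K.starProjection.range = K := by simp
  rw [this] at hx ⊢
  exact h m hm x hx

lemma cfc_mem_vN (M : VonNeumannAlgebra H) (T : H →L[ℂ] H) (hT : T ∈ M) (f : ℝ → ℝ) :
    cfc f T ∈ M := by
  apply mem_vN_of_commute
  intro m hm
  have : Commute T m := (VonNeumannAlgebra.mem_commutant_iff.1 hm) T hT
  exact (this.cfc_real f).symm

lemma proj_inner {h : H →L[ℂ] H} (hs : star h = h) (hh : h * h = h) (x y : H) :
    inner ℂ (h x) y = inner ℂ (h x) (h y) := by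
  have h1 : inner ℂ (h x) (h y) = inner ℂ ((star h) (h x)) y := by
    rw [ContinuousLinearMap.star_eq_adjoint, ContinuousLinearMap.adjoint_inner_left]
  rw [h1, hs]
  change _ = inner ℂ ((h * h) x) y
  rw [hh]

lemma proj_pyth {h : H →L[ℂ] H} (hs : star h = h) (hh : h * h = h) (x : H) :
    ‖h x‖ ^ 2 + ‖x - h x‖ ^ 2 = ‖x‖ ^ 2 := by
  have h0 : inner ℂ (h x) (x - h x) = 0 := by
    rw [inner_sub_right, proj_inner hs hh, sub_self]
  have := norm_add_sq_eq_norm_sq_add_norm_sq_of_inner_eq_zero _ _ h0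
  simp only [add_sub_cancel] at this
  nlinarith

lemma proj_norm_le {h : H →L[ℂ] H} (hs : star h = h) (hh : h * h = h) (x : H) :
    ‖h x‖ ≤ ‖x‖ := by
  have := proj_pyth hs hh x
  exact (sq_le_sq₀ (norm_nonneg _) (norm_nonneg _)).1 (by nlinarith [sq_nonneg ‖x - h x‖])

lemma proj_compl {M : VonNeumannAlgebra H} {h : H →L[ℂ] H} (hp : IsProjectionIn M h) :
    IsProjectionIn M (1 - h) := by
  refine ⟨sub_mem (one_mem M) hp.1, by simp [hp.2.1], ?_⟩
  simp [mul_sub, sub_mul, hp.2.2]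

lemma star_mul_norm {v : H →L[ℂ] H} {h : H →L[ℂ] H} (hs : star h = h) (hh : h * h = h)
    (hv : star v * v = h) (x : H) : ‖v x‖ = ‖h x‖ := by
  have h1 : (inner ℂ (v x) (v x) : ℂ) = inner ℂ (h x) (h x) := by
    rw [← proj_inner hs hh, ← hv]
    change _ = inner ℂ ((star v) (v x)) x
    rw [ContinuousLinearMap.star_eq_adjoint, ContinuousLinearMap.adjoint_inner_left]
  rw [inner_self_eq_norm_sq_to_K, inner_self_eq_norm_sq_to_K] at h1
  have h2 : ‖v x‖ ^ 2 = ‖h x‖ ^ 2 := by exact_mod_cast h1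
  exact (sq_eq_sq₀ (norm_nonneg _) (norm_nonneg _)).1 h2

/-- replacing a corner of a contraction by a partial isometry -/
def modif (c h f v : H →L[ℂ] H) : H →L[ℂ] H := (1 - h) * c * (1 - f) + star v

lemma modif_norm_le {c h f v : H →L[ℂ] H} (hc : ‖c‖ ≤ 1) (hs : star h = h) (hh : h * h = h)
    (fs : star f = f) (ff : f * f = f) (hvf : v * star v = f)
    (hvh : v * h = v) : ‖modif c h f v‖ ≤ 1 := by
  refine ContinuousLinearMap.opNorm_le_bound _ zero_le_one fun x => ?_
  have h1 : h * star v = star v := by rw [← hs, ← star_mul, hvh]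
  have h1' : ∀ z, h (star v z) = star v z := fun z => by
    change (h * star v) z = _; rw [h1]
  set z := c (x - f x) with hz
  have e1 : modif c h f v x = (z - h z) + star v x := by simp [modif, hz]
  have h2 : inner ℂ (star v x) (z - h z) = 0 := by
    rw [← h1', inner_sub_right, proj_inner hs hh, sub_self]
  have h3 := norm_add_sq_eq_norm_sq_add_norm_sq_of_inner_eq_zero _ _ h2
  rw [add_comm, ← e1] at h3
  have h4 : ‖star v x‖ = ‖f x‖ := star_mul_norm fs ff (by simpa using hvf) x
  have h5 := proj_pyth hs hh z
  have h6 := proj_pyth fs ff x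
  have h7 : ‖z‖ ≤ ‖x - f x‖ := by
    calc ‖z‖ ≤ ‖c‖ * ‖x - f x‖ := c.le_opNorm _
      _ ≤ 1 * ‖x - f x‖ := by gcongr
      _ = _ := one_mul _
  rw [one_mul]
  rw [h4] at h3
  have h8 : ‖z‖ ^ 2 ≤ ‖x - f x‖ ^ 2 := by gcongr
  refine (sq_le_sq₀ (norm_nonneg _) (norm_nonneg _)).1 ?_
  nlinarith [sq_nonneg ‖h z‖]

lemma modif_close {c h f v : H →L[ℂ] H} (hc : ‖c‖ ≤ 1) (hs : star h = h) (hh : h * h = h)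
    (fs : star f = f) (ff : f * f = f) (hvf : v * star v = f) (x : H) :
    ‖modif c h f v x - c x‖ ≤ ‖h (c x)‖ + 3 * ‖f x‖ := by
  have h4 : ‖star v x‖ = ‖f x‖ := star_mul_norm fs ff (by simpa using hvf) x
  have e1 : modif c h f v x - c x = - h (c x) + h (c (f x)) - c (f x) + star v x := by
    simp [modif]; abel
  have h5 : ‖c (f x)‖ ≤ ‖f x‖ := by
    calc _ ≤ ‖c‖ * ‖f x‖ := c.le_opNorm _
      _ ≤ 1 * ‖f x‖ := by gcongr
      _ = _ := one_mul _
  have h6 := proj_norm_le hs hh (c (f x))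
  rw [e1]
  have a1 := norm_add_le (- h (c x) + h (c (f x)) - c (f x)) (star v x)
  have a2 := norm_sub_le (- h (c x) + h (c (f x))) (c (f x))
  have a3 := norm_add_le (- h (c x)) (h (c (f x)))
  rw [norm_neg] at a3
  linarith

lemma proj_small_sum (M : VonNeumannAlgebra H) (hM : M.Atomless) (F : Finset H)
    {e : H →L[ℂ] H} (he : IsProjectionIn M e) (he0 : e ≠ 0) (k : ℕ) :
    ∃ f, IsProjectionIn M f ∧ f ≠ 0 ∧ e * f = f ∧
      ∑ x ∈ F, ‖f x‖ ^ 2 ≤ (1 / 2) ^ k * ∑ x ∈ F, ‖e x‖ ^ 2 := by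
  induction k with
  | zero => exact ⟨e, he, he0, he.2.2, by simp⟩
  | succ k ih =>
    obtain ⟨f, hf, hf0, hef, hsum⟩ := ih
    have := hM f
    unfold IsMinimalProjectionIn at this
    push Not at this
    obtain ⟨q, hq, hfq, hq0, hqf⟩ := this hf hf0
    have hqf' : q * f = q := by
      have := congrArg star hfq
      rwa [star_mul, hq.2.1, hf.2.1] at this
    have hr : IsProjectionIn M (f - q) := by
      refine ⟨sub_mem hf.1 hq.1, by simp [hf.2.1, hq.2.1], ?_⟩
      simp [mul_sub, sub_mul, hf.2.2, hq.2.2, hfq, hqf']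
    have key : ∑ x ∈ F, ‖q x‖ ^ 2 + ∑ x ∈ F, ‖(f - q) x‖ ^ 2 = ∑ x ∈ F, ‖f x‖ ^ 2 := by
      rw [← Finset.sum_add_distrib]
      refine Finset.sum_congr rfl fun x _ => ?_
      have := proj_pyth hq.2.1 hq.2.2 (f x)
      have e2 : q (f x) = q x := by change (q * f) x = _; rw [hqf']
      rw [e2] at this
      simpa using this
    rw [pow_succ]
    rcases le_total (∑ x ∈ F, ‖q x‖ ^ 2) (∑ x ∈ F, ‖(f - q) x‖ ^ 2) with h | h
    · refine ⟨q, hq, hq0, ?_, by linarith⟩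
      rw [← hfq, ← mul_assoc, hef]
    · refine ⟨f - q, hr, sub_ne_zero.2 (Ne.symm hqf), ?_, by linarith⟩
      rw [mul_sub, hef, ← hfq, ← mul_assoc, hef]

lemma proj_small (M : VonNeumannAlgebra H) (hM : M.Atomless) (F : Finset H)
    {e : H →L[ℂ] H} (he : IsProjectionIn M e) (he0 : e ≠ 0) {δ : ℝ} (hδ : 0 < δ) :
    ∃ f, IsProjectionIn M f ∧ f ≠ 0 ∧ e * f = f ∧ ∀ x ∈ F, ‖f x‖ ≤ δ := by
  have ht : Filter.Tendsto (fun k : ℕ => (1 / 2 : ℝ) ^ k * ∑ x ∈ F, ‖e x‖ ^ 2) Filter.atTop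
      (nhds (0 * ∑ x ∈ F, ‖e x‖ ^ 2)) :=
    (tendsto_pow_atTop_nhds_zero_of_lt_one (by norm_num) (by norm_num)).mul_const _
  rw [zero_mul] at ht
  obtain ⟨k, hk⟩ := (ht.eventually (gt_mem_nhds (show 0 < δ ^ 2 by positivity))).exists
  obtain ⟨f, hf, hf0, hef, hs⟩ := proj_small_sum M hM F he he0 k
  refine ⟨f, hf, hf0, hef, fun x hx => ?_⟩
  have h1 : ‖f x‖ ^ 2 ≤ ∑ x ∈ F, ‖f x‖ ^ 2 :=
    Finset.single_le_sum (f := fun x => ‖f x‖ ^ 2) (fun _ _ => by positivity) hx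
  exact (sq_le_sq₀ (norm_nonneg _) hδ.le).1 (by linarith)


lemma range_proj_mem (M : VonNeumannAlgebra H) {R : H →L[ℂ] H} (hR : R ∈ M) :
    ∃ h, IsProjectionIn M h ∧ h * R = R ∧ (∀ z, h z ∈ closure (Set.range R)) ∧
      ∀ A : H →L[ℂ] H, A * R = 0 → A * h = 0 := by
  set K : Submodule ℂ H := R.range.topologicalClosure with hK
  have : CompleteSpace K := R.range.isClosed_topologicalClosure.completeSpace_coe
  refine ⟨K.starProjection, proj_starProjection_mem M K ?_, ?_,
    fun z => Submodule.starProjection_apply_mem K z, ?_⟩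
  · intro m hm x hx
    have hmR : ∀ z, m (R z) = R (m z) := fun z =>
      (DFunLike.congr_fun (VonNeumannAlgebra.mem_commutant_iff.1 hm R hR) z).symm
    have : Set.MapsTo m (R.range : Set H) (R.range : Set H) := by
      rintro _ ⟨z, rfl⟩
      exact ⟨m z, (hmR z).symm⟩
    exact this.closure m.continuous hx
  · ext z
    exact Submodule.starProjection_eq_self_iff.2 (R.range.le_topologicalClosure ⟨z, rfl⟩)
  · intro A hA
    ext z
    have hz : K.starProjection z ∈ K := Submodule.starProjection_apply_mem K z
    have : Set.EqOn A (0 : H →L[ℂ] H) (R.range : Set H) := by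
      rintro _ ⟨z, rfl⟩
      exact DFunLike.congr_fun hA z
    exact this.closure A.continuous (0 : H →L[ℂ] H).continuous hz

/-- lower bound on the range of a range projection -/
lemma range_lower {R B : H →L[ℂ] H} {κ : ℝ} (h : H →L[ℂ] H)
    (hlow : ∀ z, κ * ‖R z‖ ≤ ‖B (R z)‖)
    (hcl : ∀ z, h z ∈ closure (Set.range R)) (z : H) : κ * ‖h z‖ ≤ ‖B (h z)‖ := by
  have hc : IsClosed {x : H | κ * ‖x‖ ≤ ‖B x‖} :=
    isClosed_le (by fun_prop) (by fun_prop)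
  refine closure_minimal ?_ hc (hcl z)
  rintro _ ⟨z, rfl⟩
  exact hlow z

lemma spec_lemma (M : VonNeumannAlgebra H) {x : H →L[ℂ] H} (hx : x ∈ M) {c : ℝ} (hc : 0 < c)
    (hcx : c < ‖x‖) : ∃ h t, IsProjectionIn M h ∧ h ≠ 0 ∧ t ∈ M ∧
      star (x * t) * (x * t) * h = h ∧
      (∀ p, star p = p → x * p = x → p * h = h) ∧
      ∀ z, (c + 1) * ‖h z‖ ≤ ‖(x + x * t) (h z)‖ := by
  set T : H →L[ℂ] H := star x * x with hT
  have hTM : T ∈ M := mul_mem (star_mem hx) hx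
  have hTs : IsSelfAdjoint T := IsSelfAdjoint.star_mul_self x
  have hT0 : 0 ≤ T := star_mul_self_nonneg x
  have hsp : ∀ s ∈ spectrum ℝ T, 0 ≤ s := fun s hs => spectrum_nonneg_of_nonneg hT0 hs
  have hnorm : ‖T‖ = ‖x‖ ^ 2 := by rw [hT, CStarRing.norm_star_mul_self, sq]
  have hc2 : 0 < c ^ 2 := by positivity
  let φ : ℝ → ℝ := fun s => (√(max s (c ^ 2)))⁻¹
  let σ : ℝ → ℝ := fun s => max (s - c ^ 2) 0 / max s (c ^ 2)
  let r : ℝ → ℝ := fun s => max (s - c ^ 2) 0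
  have hmax : ∀ s, 0 < max s (c ^ 2) := fun s => lt_max_of_lt_right hc2
  have hφc : Continuous φ :=
    Continuous.inv₀ (by fun_prop) fun s => (Real.sqrt_pos.2 (hmax s)).ne'
  have hσc : Continuous σ := Continuous.div₀ (by fun_prop) (by fun_prop) fun s => (hmax s).ne'
  have hrc : Continuous r := by fun_prop
  set t := cfc φ T with ht
  set R := cfc r T with hR
  have htM : t ∈ M := cfc_mem_vN M T hTM φ
  have hRM : R ∈ M := cfc_mem_vN M T hTM r
  have hts : star t = t := (cfc_predicate φ T : IsSelfAdjoint _).star_eq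
  have hRs : star R = R := (cfc_predicate r T : IsSelfAdjoint _).star_eq
  have hid : cfc (fun s : ℝ => s) T = T := cfc_id' ℝ T
  have hRT : R = T * cfc σ T := by
    have e := cfc_mul (fun s : ℝ => s) σ T (by fun_prop) hσc.continuousOn
    rw [hid] at e
    rw [← e]
    refine cfc_congr fun s hs => ?_
    simp only [r, σ]
    rcases le_total s (c ^ 2) with h | h
    · simp [h]
    · have : s ≠ 0 := by linarith
      rw [max_eq_left h]; field_simp
  have hsq : ∀ s, c ^ 2 ≤ s → φ s * √s = 1 ∧ c ≤ √s ∧ √s * √s = s := by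
    intro s h
    refine ⟨?_, Real.le_sqrt_of_sq_le h, Real.mul_self_sqrt (by linarith)⟩
    simp only [φ]
    rw [max_eq_left h]
    exact inv_mul_cancel₀ (Real.sqrt_pos.2 (by linarith)).ne'
  have F1 : t * T * t * R = R := by
    have e1 := cfc_mul φ (fun s : ℝ => s) T hφc.continuousOn (by fun_prop)
    have e2 := cfc_mul (fun s => φ s * s) φ T (by fun_prop) hφc.continuousOn
    have e3 := cfc_mul (fun s => φ s * s * φ s) r T (by fun_prop) hrc.continuousOn
    rw [e2, e1, hid] at e3
    rw [← e3]
    refine cfc_congr fun s hs => ?_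
    rcases le_total s (c ^ 2) with h | h
    · simp [r, h]
    · obtain ⟨h1, h2, h3⟩ := hsq s h
      have : φ s * s * φ s = 1 := by
        linear_combination (φ s * √s + 1) * h1 - (φ s) ^ 2 * h3
      rw [this, one_mul]
  have hone : cfc (fun _ : ℝ => (1 : ℝ)) T = 1 := cfc_const_one ℝ T
  have F3 : 0 ≤ R * (1 + t) * T * (1 + t) * R - ((c + 1) ^ 2) • (R * R) := by
    have e0 := cfc_add T (fun _ : ℝ => (1 : ℝ)) φ (by fun_prop) hφc.continuousOn
    rw [hone] at e0
    have e1 := cfc_mul r (fun s => 1 + φ s) T hrc.continuousOn (by fun_prop)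
    have e2 := cfc_mul (fun s => r s * (1 + φ s)) (fun s : ℝ => s) T (by fun_prop) (by fun_prop)
    have e3 := cfc_mul (fun s => r s * (1 + φ s) * s) (fun s => 1 + φ s) T
      (by fun_prop) (by fun_prop)
    have e4 := cfc_mul (fun s => r s * (1 + φ s) * s * (1 + φ s)) r T (by fun_prop) (by fun_prop)
    have e5 := cfc_mul r r T (by fun_prop) (by fun_prop)
    have e6 := cfc_smul ((c + 1) ^ 2) (fun s => r s * r s) T (by fun_prop)
    have e7 := cfc_sub (a := T) (f := fun s : ℝ => r s * (1 + φ s) * s * (1 + φ s) * r s)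
      (g := fun s : ℝ => ((c + 1) ^ 2) • (r s * r s)) (by fun_prop) (by fun_prop)
    rw [e6, e5, e4, e3, e2, e1, e0, hid] at e7
    rw [← e7]
    refine cfc_nonneg fun s hs => ?_
    rcases le_total s (c ^ 2) with h | h
    · simp [r, h]
    · obtain ⟨h1, h2, h3⟩ := hsq s h
      have : (1 + φ s) * s * (1 + φ s) = (√s + 1) ^ 2 := by
        linear_combination (2 * √s + φ s * √s + 1) * h1 - (1 + φ s) ^ 2 * h3
      have h5 : (c + 1) ^ 2 ≤ (√s + 1) ^ 2 := by gcongr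
      have : r s * (1 + φ s) * s * (1 + φ s) * r s - (c + 1) ^ 2 • (r s * r s)
         = r s * r s * ((√s + 1) ^ 2 - (c + 1) ^ 2) := by
        rw [← this, smul_eq_mul]; ring
      rw [this]
      exact mul_nonneg (mul_self_nonneg _) (by linarith)
  have F3' : ∀ z, (c + 1) * ‖R z‖ ≤ ‖(x + x * t) (R z)‖ := by
    intro z
    have hp := (ContinuousLinearMap.nonneg_iff_isPositive _).1 F3
    have h1 := hp.re_inner_nonneg_left z
    have e1 : R * (1 + t) * T * (1 + t) * R
        = star ((x + x * t) * R) * ((x + x * t) * R) := by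
      simp only [star_mul, star_add, hts, hRs, hT]
      noncomm_ring
    have e2 : R * R = star R * R := by rw [hRs]
    have e3 : ∀ (A : H →L[ℂ] H), inner ℂ ((star A * A) z) z = ((‖A z‖ ^ 2 : ℝ) : ℂ) := by
      intro A
      change inner ℂ ((star A) (A z)) z = _
      rw [ContinuousLinearMap.star_eq_adjoint, ContinuousLinearMap.adjoint_inner_left,
        inner_self_eq_norm_sq_to_K]
      push_cast; rfl
    have e4 : (((c + 1) ^ 2 • (star R * R) : H →L[ℂ] H)) z
        = (((c + 1) ^ 2 : ℝ) : ℂ) • ((star R * R) z) := by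
      rw [Complex.coe_smul]; rfl
    rw [e1, e2, sub_apply, inner_sub_left, e3, e4, inner_smul_left, e3,
      Complex.conj_ofReal, ← Complex.ofReal_mul, ← Complex.ofReal_sub] at h1
    have h2 : 0 ≤ ‖((x + x * t) * R) z‖ ^ 2 - (c + 1) ^ 2 * ‖R z‖ ^ 2 := h1
    refine (sq_le_sq₀ (by positivity) (norm_nonneg _)).1 ?_
    rw [mul_pow]
    change _ ≤ ‖((x + x * t) * R) z‖ ^ 2
    linarith
  obtain ⟨h, hhp, hhR, hhcl, hhA⟩ := range_proj_mem M hRM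
  have hx0 : x ≠ 0 := by rintro rfl; simp at hcx; linarith
  have : Nontrivial (H →L[ℂ] H) := ⟨x, 0, hx0⟩
  have hR0 : R ≠ 0 := by
    intro h0
    have h1 : ‖T‖ ∈ spectrum ℝ T := CStarAlgebra.norm_mem_spectrum_of_nonneg hT0
    have h2 := norm_apply_le_norm_cfc r T h1
    rw [← hR, h0, norm_zero, hnorm] at h2
    have h3 : c ^ 2 < ‖x‖ ^ 2 := by gcongr
    have h4 : r (‖x‖ ^ 2) = ‖x‖ ^ 2 - c ^ 2 := max_eq_left (by linarith)
    have := norm_le_zero_iff.1 h2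
    linarith
  refine ⟨h, t, hhp, ?_, htM, ?_, ?_, range_lower h F3' hhcl⟩
  · rintro rfl
    exact hR0 (by rw [← hhR, zero_mul])
  · have : star (x * t) * (x * t) = t * T * t := by
      rw [star_mul, hts, hT]; noncomm_ring
    rw [this]
    have := hhA (t * T * t - 1) (by rw [sub_mul, F1, one_mul, sub_self])
    rwa [sub_mul, one_mul, sub_eq_zero] at this
  · intro p hp hxp
    have h1 : p * star x = star x := by
      have := congrArg star hxp
      rwa [star_mul, hp] at this
    have h2 : p * R = R := by rw [hRT, hT, ← mul_assoc, ← mul_assoc, h1]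
    have := hhA (p - 1) (by rw [sub_mul, h2, one_mul, sub_self])
    rwa [sub_mul, one_mul, sub_eq_zero] at this


lemma weak_limit (M : VonNeumannAlgebra H) (b : ℕ → H →L[ℂ] H) (hb : ∀ k, b k ∈ M)
    (hn : ∀ k, ‖b k‖ ≤ 1) : ∃ c ∈ M, ‖c‖ ≤ 1 ∧
      ∀ (z η : H) (r : ℝ), (∀ᶠ k in Filter.atTop, ‖b k z - η‖ ≤ r) → ‖c z - η‖ ≤ r := by
  let U : Ultrafilter ℕ := Filter.hyperfilter ℕ
  have hU : (U : Filter ℕ) ≤ Filter.atTop := Nat.hyperfilter_le_atTop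
  have hbz : ∀ k z, ‖b k z‖ ≤ ‖z‖ := fun k z => by
    calc ‖b k z‖ ≤ ‖b k‖ * ‖z‖ := (b k).le_opNorm z
      _ ≤ 1 * ‖z‖ := by gcongr; exact hn k
      _ = _ := one_mul _
  have hbd : ∀ k x z, ‖(inner ℂ (b k x) z : ℂ)‖ ≤ ‖x‖ * ‖z‖ := fun k x z =>
    (norm_inner_le_norm _ _).trans (by gcongr; exact hbz k x)
  have hL : ∀ x z : H, ∃ l : ℂ, Filter.Tendsto (fun k => (inner ℂ (b k x) z : ℂ)) U (nhds l) := by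
    intro x z
    obtain ⟨l, -, hl⟩ := (isCompact_closedBall (0 : ℂ) (‖x‖ * ‖z‖)).ultrafilter_le_nhds
      (U.map fun k => (inner ℂ (b k x) z : ℂ)) (by
        rw [Filter.le_principal_iff]
        exact Filter.mem_map.2 (Filter.Eventually.of_forall fun k => by simpa using hbd k x z))
    exact ⟨l, hl⟩
  choose L hL using hL
  have huniq : ∀ {f : ℕ → ℂ} {l l' : ℂ}, Filter.Tendsto f U (nhds l) →
    Filter.Tendsto f U (nhds l') → l = l' := fun h h' => tendsto_nhds_unique h h'
  let B0 : H →ₗ⋆[ℂ] H →ₗ[ℂ] ℂ := LinearMap.mk₂'ₛₗ (starRingEnd ℂ) (RingHom.id ℂ) L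
    (fun x x' z => huniq (hL _ _) (by
      simpa [inner_add_left] using (hL x z).add (hL x' z)))
    (fun a x z => huniq (hL _ _) (by
      simpa [inner_smul_left, mul_comm] using (hL x z).const_mul (starRingEnd ℂ a)))
    (fun x z z' => huniq (hL _ _) (by
      simpa [inner_add_right] using (hL x z).add (hL x z')))
    (fun a x z => huniq (hL _ _) (by
      simpa [inner_smul_right] using (hL x z).const_mul a))
  let B : H →L⋆[ℂ] H →L[ℂ] ℂ := B0.mkContinuous₂ 1 (fun x z => by
    rw [one_mul]
    exact le_of_tendsto (hL x z).norm (Filter.Eventually.of_forall fun k => hbd k x z))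
  let c : H →L[ℂ] H := InnerProductSpace.continuousLinearMapOfBilin B
  have hc : ∀ x z, Filter.Tendsto (fun k => (inner ℂ (b k x) z : ℂ)) U (nhds (inner ℂ (c x) z)) := by
    intro x z
    have : inner ℂ (c x) z = L x z := InnerProductSpace.continuousLinearMapOfBilin_apply B x z
    rw [this]
    exact hL x z
  have key : ∀ (z η : H) (r : ℝ),
      (∀ᶠ k in Filter.atTop, ‖b k z - η‖ ≤ r) → ‖c z - η‖ ≤ r := by
    intro z η r hr
    set w := c z - η with hw
    have hr0 : 0 ≤ r := by
      obtain ⟨k, hk⟩ := hr.exists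
      exact (norm_nonneg _).trans hk
    have h1 : Filter.Tendsto (fun k => (inner ℂ (b k z - η) w : ℂ)) U (nhds (inner ℂ w w)) := by
      have := (hc z w).sub_const (inner ℂ η w)
      simpa only [← inner_sub_left] using this
    have h2 : ‖(inner ℂ w w : ℂ)‖ ≤ r * ‖w‖ := by
      refine le_of_tendsto h1.norm ((hr.filter_mono hU).mono fun k hk => ?_)
      exact (norm_inner_le_norm _ _).trans (by gcongr)
    rw [inner_self_eq_norm_sq_to_K] at h2
    have h3 : ‖w‖ * ‖w‖ ≤ r * ‖w‖ := by simpa [sq] using h2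
    rcases (norm_nonneg w).eq_or_lt with h | h
    · rw [← h]; exact hr0
    · exact le_of_mul_le_mul_right h3 h
  refine ⟨c, ?_, ?_, key⟩
  · apply mem_vN_of_commute
    intro m hm
    ext x
    refine ext_inner_right ℂ fun z => ?_
    change inner ℂ (m (c x)) z = inner ℂ (c (m x)) z
    have h1 := hc (m x) z
    have h2 := hc x (star m z)
    have e : ∀ y, inner ℂ y (star m z) = inner ℂ (m y) z := fun y => by
      rw [ContinuousLinearMap.star_eq_adjoint, ContinuousLinearMap.adjoint_inner_right]
    simp only [e] at h2
    have e2 : ∀ k, m (b k x) = b k (m x) := fun k =>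
      (DFunLike.congr_fun (VonNeumannAlgebra.mem_commutant_iff.1 hm (b k) (hb k)) x).symm
    simp only [e2] at h2
    exact tendsto_nhds_unique h2 h1
  · refine ContinuousLinearMap.opNorm_le_bound _ zero_le_one fun x => ?_
    have := key x 0 ‖x‖ (Filter.Eventually.of_forall fun k => by simpa using hbz k x)
    simpa using this

lemma sup_finite (M : VonNeumannAlgebra H) (S : Set (H →L[ℂ] H))
    (hS : ∀ s ∈ S, IsFiniteProjectionIn M s)
    (hd : ∀ s ∈ S, ∀ t ∈ S, s ≠ t → ∀ z ∈ M, s * z * t = 0) :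
    ∃ p, IsFiniteProjectionIn M p ∧ ∀ s ∈ S, p * s = s := by
  set A : Set H := {x | ∃ s ∈ S, s x = x} with hA
  set K : Submodule ℂ H := (Submodule.span ℂ A).topologicalClosure with hK
  have : CompleteSpace K := (Submodule.span ℂ A).isClosed_topologicalClosure.completeSpace_coe
  have hAK : ∀ x ∈ A, x ∈ K := fun x hx =>
    Submodule.le_topologicalClosure _ (Submodule.subset_span hx)
  have hmin : ∀ N : Submodule ℂ H, IsClosed (N : Set H) → (∀ x ∈ A, x ∈ N) → K ≤ N :=
    fun N hN h => Submodule.topologicalClosure_minimal _ (Submodule.span_le.2 h) hN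
  set p := K.starProjection with hp
  have hself : ∀ s ∈ S, ∀ x, s (s x) = s x := fun s hs x => by
    change (s * s) x = s x; rw [(hS s hs).1.2.2]
  have hpM : IsProjectionIn M p := by
    apply proj_starProjection_mem
    intro m hm
    refine hmin (K.comap (m : H →ₗ[ℂ] H)) ?_ ?_
    · exact (Submodule.span ℂ A).isClosed_topologicalClosure.preimage m.continuous
    · rintro x ⟨s, hs, hx⟩
      refine hAK _ ⟨s, hs, ?_⟩
      change (s * m) x = m x
      rw [VonNeumannAlgebra.mem_commutant_iff.1 hm s (hS s hs).1.1]
      change m (s x) = m x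
      rw [hx]
  have hps : ∀ s ∈ S, p * s = s := by
    intro s hs
    ext x
    exact Submodule.starProjection_eq_self_iff.2 (hAK _ ⟨s, hs, hself s hs x⟩)
  -- operators agreeing on `A` agree after multiplication by `p`
  have hext : ∀ C : H →L[ℂ] H, (∀ s ∈ S, C * s = 0) → C * p = 0 := by
    intro C hC
    have : K ≤ C.ker := by
      refine hmin _ (ContinuousLinearMap.isClosed_ker C) ?_
      rintro x ⟨s, hs, hx⟩
      have : (C * s) x = 0 := by rw [hC s hs]; rfl
      change C x = 0
      rw [← hx]; exact this
    ext x
    exact this (Submodule.starProjection_apply_mem K x)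
  have hcomm : ∀ v ∈ M, p * v = v → ∀ s ∈ S, s * v * s = v * s := by
    intro v hv hpv s hs
    have h1 : star (v * s - s * v * s) * p = 0 := by
      apply hext
      intro t ht
      rw [← star_star (star (v * s - s * v * s) * t), star_mul, star_star, (hS t ht).1.2.1]
      rw [star_eq_zero, mul_sub]
      by_cases hts : t = s
      · subst hts
        rw [mul_assoc t v t, ← mul_assoc t t, (hS t ht).1.2.2, sub_self]
      · have e1 := hd t ht s hs hts v hv
        have e2 := hd t ht s hs hts 1 (one_mem M)
        rw [mul_one] at e2
        rw [← mul_assoc, e1, ← mul_assoc, ← mul_assoc, e2, zero_mul, zero_mul, sub_self]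
    have h2 := congrArg star h1
    rw [star_mul, star_star, star_zero, hpM.2.1, mul_sub, ← mul_assoc, hpv, ← mul_assoc,
      ← mul_assoc, hps s hs, sub_eq_zero] at h2
    exact h2.symm
  refine ⟨p, ⟨hpM, ?_⟩, hps⟩
  rintro q hq hpq ⟨v, hv, hvp, hvq⟩
  have hqp : q * p = q := by
    have := congrArg star hpq
    rwa [star_mul, hq.2.1, hpM.2.1] at this
  have hvp' : v * p = v := by
    have : star (v - v * p) * (v - v * p) = 0 := by
      have e : star (v - v * p) * (v - v * p)
        = star v * v - star v * v * p - p * (star v * v) + p * (star v * v) * p := by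
        rw [star_sub, star_mul, hpM.2.1]; noncomm_ring
      rw [e, hvp, hpM.2.2, hpM.2.2]; simp
    have := CStarRing.star_mul_self_eq_zero_iff _ |>.1 this
    exact (sub_eq_zero.1 this).symm
  have hpv : p * v = v := by
    calc p * v = p * (v * p) := by rw [hvp']
      _ = p * (v * star v) * v := by rw [← hvp]; noncomm_ring
      _ = v * p := by rw [hvq, hpq, ← hvq, ← hvp]; noncomm_ring
      _ = v := hvp'
  have hpv' : p * star v = star v := by
    have := congrArg star hvp'
    rwa [star_mul, hpM.2.1] at this
  have hqs : ∀ s ∈ S, q * s = s := by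
    intro s hs
    have ss := (hS s hs).1.2.1
    have s2 := (hS s hs).1.2.2
    have c1 := hcomm v hv hpv s hs
    have c2 := hcomm (star v) (star_mem hv) hpv' s hs
    have c3 : s * v = v * s := by
      have := congrArg star c2
      simp only [star_mul, star_star, ss] at this
      rw [← this, ← mul_assoc, c1]
    have c4 : s * star v = star v * s := by
      have := congrArg star c3
      simpa only [star_mul, star_star, ss] using this.symm
    have c5 : s * q = q * s := by
      rw [← hvq, ← mul_assoc, c3, mul_assoc, c4, mul_assoc]
    have sp : p * s = s := hps s hs
    have hfin := (hS s hs).2 (q * s) ⟨mul_mem hq.1 (hS s hs).1.1, by rw [star_mul, ss, hq.2.1, c5], by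
      rw [mul_assoc, ← mul_assoc s, c5, mul_assoc q s s, s2, ← mul_assoc, hq.2.2]⟩
      (by rw [← mul_assoc, c5, mul_assoc, s2]) ⟨v * s, mul_mem hv (hS s hs).1.1, by
        rw [star_mul, ss, mul_assoc, ← mul_assoc (star v), hvp, sp, s2], by
        rw [star_mul, ss, mul_assoc, ← mul_assoc s, s2, c4, ← mul_assoc, hvq]⟩
    exact hfin
  have := hext (q - 1) (fun s hs => by rw [sub_mul, hqs s hs, one_mul, sub_self])
  rw [sub_mul, one_mul, sub_eq_zero, hqp] at this
  exact this

lemma exists_big_finite (M : VonNeumannAlgebra H) (hsf : M.Semifinite) :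
    ∃ p, IsFiniteProjectionIn M p ∧ ∀ e, IsProjectionIn M e → e ≠ 0 → ∃ z ∈ M, e * z * p ≠ 0 := by
  obtain ⟨S, hSm⟩ := zorn_subset {S : Set (H →L[ℂ] H) | (∀ s ∈ S, IsFiniteProjectionIn M s) ∧
    ∀ s ∈ S, ∀ t ∈ S, s ≠ t → ∀ z ∈ M, s * z * t = 0} (by
      intro C hC hch
      refine ⟨⋃₀ C, ⟨?_, ?_⟩, fun s hs => Set.subset_sUnion_of_mem hs⟩
      · rintro s ⟨D, hD, hs⟩
        exact (hC hD).1 s hs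
      · rintro s ⟨D, hD, hs⟩ t ⟨D', hD', ht⟩ hst z hz
        rcases hch.total hD hD' with h | h
        · exact (hC hD').2 s (h hs) t ht hst z hz
        · exact (hC hD).2 s hs t (h ht) hst z hz)
  obtain ⟨p, hp, hps⟩ := sup_finite M S hSm.prop.1 hSm.prop.2
  refine ⟨p, hp, fun e he he0 => ?_⟩
  by_contra! hcon
  obtain ⟨f, hf, hf0, hef⟩ := hsf e he he0
  have hfe : f * e = f := by
    have := congrArg star hef
    rwa [star_mul, he.2.1, hf.1.2.1] at this
  have h1 : ∀ z ∈ M, ∀ s ∈ S, f * z * s = 0 := by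
    intro z hz s hs
    calc f * z * s = (f * e) * z * (p * s) := by rw [hfe, hps s hs]
      _ = f * (e * z * p) * s := by noncomm_ring
      _ = 0 := by rw [hcon z hz]; simp
  have h2 : ∀ z ∈ M, ∀ s ∈ S, s * z * f = 0 := by
    intro z hz s hs
    have := congrArg star (h1 (star z) (star_mem hz) s hs)
    simpa only [star_mul, star_star, star_zero, hf.1.2.1, (hSm.prop.1 s hs).1.2.1, mul_assoc]
      using this
  have hfS : f ∉ S := by
    intro h
    have := h1 1 (one_mem M) f h
    rw [mul_one, hf.1.2.2] at this
    exact hf0 this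
  refine hfS (hSm.le_of_ge (y := insert f S) ⟨?_, ?_⟩ (Set.subset_insert f S) (Set.mem_insert f S))
  · rintro s (rfl | hs)
    · exact hf
    · exact hSm.prop.1 s hs
  · rintro s (rfl | hs) t (rfl | ht) hst z hz
    · exact absurd rfl hst
    · exact h1 z hz t ht
    · exact h2 z hz s hs
    · exact hSm.prop.2 s hs t ht hst z hz


lemma norming [Nontrivial H] (M : VonNeumannAlgebra H) {y : H →L[ℂ] H} (hy : y ∈ M) {δ : ℝ}
    (hδ : 0 < δ) : ∃ w ∈ M, ∃ e, IsProjectionIn M e ∧ e ≠ 0 ∧ star w * w * e = e ∧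
      ∀ z, (‖y‖ + 1 - δ) * ‖e z‖ ≤ ‖(y + w) (e z)‖ := by
  by_cases hy0 : y = 0
  · subst hy0
    refine ⟨1, one_mem M, 1, ⟨one_mem M, by simp, by simp⟩, one_ne_zero, by simp, fun z => ?_⟩
    simp only [norm_zero, zero_add, one_apply_eq_self]
    nlinarith [norm_nonneg z]
  · have hp : 0 < ‖y‖ := norm_pos_iff.2 hy0
    obtain ⟨h, t, h1, h2, h3, h4, -, h5⟩ := spec_lemma M hy (c := max (‖y‖ - δ) (‖y‖ / 2))
      (lt_max_of_lt_right (by linarith)) (max_lt (by linarith) (by linarith))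
    refine ⟨y * t, mul_mem hy h3, h, h1, h2, h4, fun z => le_trans ?_ (h5 z)⟩
    gcongr
    linarith [le_max_left (‖y‖ - δ) (‖y‖ / 2)]

lemma step_lemma [Nontrivial H] (M : VonNeumannAlgebra H) (hM : M.Atomless)
    {p : H →L[ℂ] H} (hp : IsProjectionIn M p)
    (hbig : ∀ e, IsProjectionIn M e → e ≠ 0 → ∃ z ∈ M, e * z * p ≠ 0)
    {a b y : H →L[ℂ] H} (ha : a ∈ M) (hb : b ∈ M) (hy : y ∈ M) (ha1 : ‖a‖ ≤ 1) (hb1 : ‖b‖ ≤ 1)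
    (F : Finset H) {δ η : ℝ} (hδ : 0 < δ) (hη : 0 < η) :
    ∃ a' b' : H →L[ℂ] H, ∃ ξ : H, a' ∈ M ∧ b' ∈ M ∧ ‖a'‖ ≤ 1 ∧ ‖b'‖ ≤ 1 ∧ ‖ξ‖ = 1 ∧
      ‖y‖ + 1 - δ ≤ ‖a' (p (b' ξ)) - y ξ‖ ∧
      ∀ ζ ∈ F, ‖a' ζ - a ζ‖ ≤ η ∧ ‖b' ζ - b ζ‖ ≤ η := by
  classical
  obtain ⟨w, hw, e, he, he0, hwe, hlow⟩ := norming M hy hδ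
  obtain ⟨z, hz, hx0⟩ := hbig e he he0
  set x := e * z * p with hx
  have hxM : x ∈ M := mul_mem (mul_mem he.1 hz) hp.1
  have hxp : x * p = x := by rw [hx, mul_assoc, hp.2.2]
  have hex : e * x = x := by rw [hx, ← mul_assoc, ← mul_assoc, he.2.2]
  have hxn : 0 < ‖x‖ := norm_pos_iff.2 hx0
  obtain ⟨h0, t, hh0, hh00, htM, hiso, hsub, -⟩ := spec_lemma M hxM (c := ‖x‖ / 2)
    (by linarith) (by linarith)
  set v0 := x * t with hv0
  have hv0M : v0 ∈ M := mul_mem hxM htM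
  have hev0 : e * v0 = v0 := by rw [hv0, ← mul_assoc, hex]
  have hph0 : p * h0 = h0 := hsub p hp.2.1 hxp
  obtain ⟨h, hh, hhne, hh0h, hsm⟩ := proj_small M hM
    (F.image b ∪ F.image (fun ζ => star v0 ζ) ∪ F ∪ F.image (fun ζ => star v0 (star w (a ζ)))) hh0 hh00
    (δ := η / 4) (by linarith)
  obtain ⟨hhM, hs, hhh⟩ := hh
  have hph : p * h = h := by rw [← hh0h, ← mul_assoc, hph0]
  set v := v0 * h with hv
  have hvM : v ∈ M := mul_mem hv0M hhM
  have hev : e * v = v := by rw [hv, ← mul_assoc, hev0]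
  have hvh : v * h = v := by rw [hv, mul_assoc, hhh]
  have hvv : star v * v = h := by
    calc star v * v = h * (star v0 * v0 * h) := by rw [hv, star_mul, hs]; noncomm_ring
      _ = h * (star v0 * v0 * h0 * h) := by rw [mul_assoc _ h0 h, hh0h]
      _ = h := by rw [hiso, hh0h, hhh]
  set f := v * star v with hf
  have hfs : star f = f := by rw [hf, star_mul, star_star]
  have hff : f * f = f := by
    calc f * f = v * (star v * v) * star v := by rw [hf]; noncomm_ring
      _ = f := by rw [hvv, hvh]
  set u := w * v with hu
  have huM : u ∈ M := mul_mem hw hvM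
  have huu : star u * u = h := by
    calc star u * u = star v * (star w * w) * v := by rw [hu, star_mul]; noncomm_ring
      _ = star v * (star w * w * e) * v := by
        rw [mul_assoc (star v) (star w * w * e) v, mul_assoc _ e v, hev, mul_assoc]
      _ = h := by rw [hwe, mul_assoc, hev, hvv]
  have huh : u * h = u := by rw [hu, mul_assoc, hvh]
  set k := u * star u with hk
  have hks : star k = k := by rw [hk, star_mul, star_star]
  have hkk : k * k = k := by
    calc k * k = u * (star u * u) * star u := by rw [hk]; noncomm_ring
      _ = k := by rw [huu, huh]
  have hku : k * u = u := by rw [hk, mul_assoc, huu, huh]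
  have hku' : star u * k = star u := by
    have := congrArg star hku
    rwa [star_mul, hks] at this
  have hkM : k ∈ M := mul_mem huM (star_mem huM)
  have hfM : f ∈ M := mul_mem hvM (star_mem hvM)
  have hmod : ∀ {c h f v : H →L[ℂ] H}, c ∈ M → h ∈ M → f ∈ M → v ∈ M → modif c h f v ∈ M := by
    intro c h f v hc hh hf hv
    exact add_mem (mul_mem (mul_mem (sub_mem (one_mem M) hh) hc) (sub_mem (one_mem M) hf))
      (star_mem hv)
  have hhv : h * star v = star v := by rw [← hs, ← star_mul, hvh]
  have hpv : p * star v = star v := by rw [← hhv, ← mul_assoc, hph]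
  -- a unit vector in the range of `f`
  obtain ⟨x0, hx0'⟩ : ∃ x0, h x0 ≠ 0 := by
    by_contra! hc
    exact hhne (by ext x; simpa using hc x)
  set ξ0 := v x0 with hξ0
  have hξ0n : ‖ξ0‖ ≠ 0 := by
    rw [hξ0, star_mul_norm hs hhh hvv]; simpa using hx0'
  set ξ : H := ((‖ξ0‖⁻¹ : ℝ) : ℂ) • ξ0 with hξ
  have hξn : ‖ξ‖ = 1 := by
    rw [hξ, norm_smul, Complex.norm_real, norm_inv, norm_norm, inv_mul_cancel₀ hξ0n]
  have hfv : f * v = v := by rw [hf, mul_assoc, hvv, hvh]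
  have hfξ : f ξ = ξ := by
    rw [hξ, map_smul, hξ0]; congr 1; change (f * v) x0 = _; rw [hfv]
  have heξ : e ξ = ξ := by
    rw [hξ, map_smul, hξ0]; congr 1; change (e * v) x0 = _; rw [hev]
  refine ⟨modif a k h (-star u), modif b h f v, ξ, hmod ha hkM hhM (neg_mem (star_mem huM)),
    hmod hb hhM hfM hvM, ?_, ?_, hξn, ?_, ?_⟩
  · exact modif_norm_le ha1 hks hkk hs hhh (by simp [huu]) (by rw [neg_mul, hku'])
  · exact modif_norm_le hb1 hs hhh hfs hff rfl hvh
  · have e1 : modif b h f v ξ = star v ξ := by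
      simp [modif, hfξ]
    have e2 : p (star v ξ) = star v ξ := by change (p * star v) ξ = _; rw [hpv]
    have e3 : h (star v ξ) = star v ξ := by change (h * star v) ξ = _; rw [hhv]
    have e4 : modif a k h (-star u) (star v ξ) = - w ξ := by
      simp only [modif, star_neg, star_star]
      have : u (star v ξ) = w ξ := by
        rw [hu]; change w (f ξ) = _; rw [hfξ]
      simp [e3, this]
    rw [e1, e2, e4]
    have := hlow ξ
    rw [heξ, hξn, mul_one] at this
    have e5 : -w ξ - y ξ = -((y + w) ξ) := by
      change _ = -(y ξ + w ξ)
      abel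
    rw [e5, norm_neg]
    exact this
  · intro ζ hζ
    have m1 : ‖h (b ζ)‖ ≤ η / 4 := hsm _ (by
      simp only [Finset.mem_union, Finset.mem_image]; exact Or.inl (Or.inl (Or.inl ⟨ζ, hζ, rfl⟩)))
    have m2 : ‖h (star v0 ζ)‖ ≤ η / 4 := hsm _ (by
      simp only [Finset.mem_union, Finset.mem_image]; exact Or.inl (Or.inl (Or.inr ⟨ζ, hζ, rfl⟩)))
    have m3 : ‖h ζ‖ ≤ η / 4 := hsm _ (by
      simp only [Finset.mem_union, Finset.mem_image]; exact Or.inl (Or.inr hζ))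
    have m4 : ‖h (star v0 (star w (a ζ)))‖ ≤ η / 4 := hsm _ (by
      simp only [Finset.mem_union, Finset.mem_image]; exact Or.inr ⟨ζ, hζ, rfl⟩)
    have hsv : star v = h * star v0 := by rw [hv, star_mul, hs]
    have hsu : star u = h * star v0 * star w := by rw [hu, star_mul, hsv]
    constructor
    · have := modif_close (c := a) (h := k) (f := h) (v := -star u) ha1 hks hkk hs hhh
        (by simp [huu]) ζ
      have q : ‖star u (a ζ)‖ = ‖k (a ζ)‖ := star_mul_norm hks hkk (by rw [star_star]) _
      rw [hsu] at q
      change ‖h (star v0 (star w (a ζ)))‖ = _ at q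
      linarith
    · have := modif_close (c := b) hb1 hs hhh hfs hff hf.symm ζ
      have q : ‖star v ζ‖ = ‖f ζ‖ := star_mul_norm hfs hff (by rw [star_star]) _
      rw [hsv] at q
      change ‖h (star v0 ζ)‖ = _ at q
      linarith


/-- **Corollary 3.6, quantitative form.** Let `M` be an atomless semifinite
von Neumann algebra on a nontrivial Hilbert space.  Then for every sequence `(y_n)` in `M`
and every `ε > 0` there exists `g` in the compact ideal `J(M)` with
`‖g - y_n‖ > ‖y_n‖ + 1 - ε` for all `n`. -/
theorem exists_far_compact_elt_of_atomless_semifinite [Nontrivial H]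
    (M : VonNeumannAlgebra H) (hM : M.Atomless) (hsf : M.Semifinite)
    (y : ℕ → (H →L[ℂ] H)) (hy : ∀ n, y n ∈ M) (ε : ℝ) (hε : 0 < ε) :
    ∃ g ∈ compactIdeal M, ∀ n, ‖g - y n‖ > ‖y n‖ + 1 - ε := by
  classical
  obtain ⟨p, hp, hbig⟩ := exists_big_finite M hsf
  set δ := ε / 4 with hδ
  have hδ0 : 0 < δ := by positivity
  -- states: two contractions of `M` and a finite set of controlled vectors
  let St := {s : (H →L[ℂ] H) × (H →L[ℂ] H) × Finset H //
    s.1 ∈ M ∧ s.2.1 ∈ M ∧ ‖s.1‖ ≤ 1 ∧ ‖s.2.1‖ ≤ 1}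
  have hstep : ∀ (n : ℕ) (s : St), ∃ (s' : St) (ξ : H), ‖ξ‖ = 1 ∧
      ‖y n‖ + 1 - δ ≤ ‖s'.1.1 (p (s'.1.2.1 ξ)) - y n ξ‖ ∧
      s.1.2.2 ⊆ s'.1.2.2 ∧ ξ ∈ s'.1.2.2 ∧ p (s'.1.2.1 ξ) ∈ s'.1.2.2 ∧
      ∀ ζ ∈ s.1.2.2, ‖s'.1.1 ζ - s.1.1 ζ‖ ≤ δ / 2 / 2 ^ n ∧
        ‖s'.1.2.1 ζ - s.1.2.1 ζ‖ ≤ δ / 2 / 2 ^ n := by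
    rintro n ⟨⟨a, b, F⟩, ha, hb, ha1, hb1⟩
    obtain ⟨a', b', ξ, h1, h2, h3, h4, h5, h6, h7⟩ := step_lemma M hM hp.1 hbig ha hb (hy n)
      ha1 hb1 F (δ := δ) (η := δ / 2 / 2 ^ n) hδ0 (by positivity)
    exact ⟨⟨⟨a', b', F ∪ {ξ, p (b' ξ)}⟩, h1, h2, h3, h4⟩, ξ, h5, h6,
      Finset.subset_union_left, by simp, by simp, h7⟩
  choose nxt ξ hξ using hstep
  let s : ℕ → St := fun n => Nat.rec ⟨⟨0, 0, ∅⟩, zero_mem M, zero_mem M, by simp, by simp⟩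
    (fun n s => nxt n s) n
  have hs : ∀ n, s (n + 1) = nxt n (s n) := fun n => rfl
  let a : ℕ → H →L[ℂ] H := fun n => (s n).1.1
  let b : ℕ → H →L[ℂ] H := fun n => (s n).1.2.1
  let F : ℕ → Finset H := fun n => (s n).1.2.2
  let x : ℕ → H := fun n => ξ n (s n)
  have hx1 : ∀ n, ‖x n‖ = 1 := fun n => (hξ n (s n)).1
  have hxy : ∀ n, ‖y n‖ + 1 - δ ≤ ‖a (n + 1) (p (b (n + 1) (x n))) - y n (x n)‖ :=
    fun n => (hξ n (s n)).2.1
  have hF : Monotone F := monotone_nat_of_le_succ fun n => (hξ n (s n)).2.2.1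
  have hxF : ∀ n, x n ∈ F (n + 1) := fun n => (hξ n (s n)).2.2.2.1
  have hpF : ∀ n, p (b (n + 1) (x n)) ∈ F (n + 1) := fun n => (hξ n (s n)).2.2.2.2.1
  have hcl : ∀ n, ∀ ζ ∈ F n, ‖a (n + 1) ζ - a n ζ‖ ≤ δ / 2 / 2 ^ n ∧
      ‖b (n + 1) ζ - b n ζ‖ ≤ δ / 2 / 2 ^ n := fun n => (hξ n (s n)).2.2.2.2.2
  -- telescoping
  have tele : ∀ (c : ℕ → H →L[ℂ] H) (n : ℕ) (ζ : H),
      (∀ k, n ≤ k → ‖c (k + 1) ζ - c k ζ‖ ≤ δ / 2 / 2 ^ k) →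
      ∀ k, ‖c (n + k) ζ - c n ζ‖ ≤ δ * (1 - 1 / 2 ^ k) := by
    intro c n ζ h k
    induction k with
    | zero => simp
    | succ k ih =>
      have h1 := h (n + k) (by omega)
      have h2 := norm_sub_le_norm_sub_add_norm_sub (c (n + k + 1) ζ) (c (n + k) ζ) (c n ζ)
      have h3 : δ / 2 / 2 ^ (n + k) ≤ δ / 2 / 2 ^ k := by
        gcongr
        · norm_num
        · omega
      have h4 : δ * (1 - 1 / 2 ^ (k + 1)) = δ / 2 / 2 ^ k + δ * (1 - 1 / 2 ^ k) := by
        rw [pow_succ]; field_simp; ring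
      rw [h4, ← add_assoc]
      linarith
  have tele' : ∀ (c : ℕ → H →L[ℂ] H) (n : ℕ) (ζ : H),
      (∀ k, n ≤ k → ‖c (k + 1) ζ - c k ζ‖ ≤ δ / 2 / 2 ^ k) →
      ∀ᶠ k in Filter.atTop, ‖c k ζ - c n ζ‖ ≤ δ := by
    intro c n ζ h
    filter_upwards [Filter.eventually_ge_atTop n] with k hk
    obtain ⟨j, rfl⟩ := Nat.exists_eq_add_of_le hk
    refine (tele c n ζ h j).trans ?_
    have : (0 : ℝ) ≤ 1 / 2 ^ j := by positivity
    nlinarith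
  obtain ⟨A, hAM, hA1, hA⟩ := weak_limit M a (fun n => (s n).2.1) (fun n => (s n).2.2.2.1)
  obtain ⟨B, hBM, hB1, hB⟩ := weak_limit M b (fun n => (s n).2.2.1) (fun n => (s n).2.2.2.2)
  refine ⟨A * p * B, subset_closure (Submodule.subset_span ⟨A, B, p, hAM, hBM, hp, rfl⟩), ?_⟩
  intro n
  set θ := p (b (n + 1) (x n)) with hθ
  have hAθ : ‖A θ - a (n + 1) θ‖ ≤ δ := hA _ _ _ (tele' a (n + 1) θ
    fun k hk => (hcl k θ (hF hk (hpF n))).1)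
  have hBx : ‖B (x n) - b (n + 1) (x n)‖ ≤ δ := hB _ _ _ (tele' b (n + 1) (x n)
    fun k hk => (hcl k (x n) (hF hk (hxF n))).2)
  have h1 : ‖A (p (B (x n))) - A θ‖ ≤ δ := by
    rw [hθ, ← map_sub, ← map_sub]
    calc ‖A (p (B (x n) - b (n + 1) (x n)))‖ ≤ ‖A‖ * ‖p (B (x n) - b (n + 1) (x n))‖ :=
          A.le_opNorm _
      _ ≤ 1 * ‖B (x n) - b (n + 1) (x n)‖ := by
          gcongr; exact proj_norm_le hp.1.2.1 hp.1.2.2 _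
      _ ≤ δ := by linarith
  have h2 := hxy n
  rw [← hθ] at h2
  have h3 : ‖(A * p * B - y n) (x n)‖ ≤ ‖A * p * B - y n‖ := by
    simpa [hx1 n] using (A * p * B - y n).le_opNorm (x n)
  have h4 : a (n + 1) θ - y n (x n) = (A * p * B - y n) (x n) - (A (p (B (x n))) - A θ)
      - (A θ - a (n + 1) θ) := by
    change _ = A (p (B (x n))) - y n (x n) - _ - _
    abel
  rw [h4] at h2
  have h5 := norm_sub_le ((A * p * B - y n) (x n) - (A (p (B (x n))) - A θ)) (A θ - a (n + 1) θ)
  have h6 := norm_sub_le ((A * p * B - y n) (x n)) (A (p (B (x n))) - A θ)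
  have : ε = 4 * δ := by rw [hδ]; ring
  linarith
end
end
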